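/- Let H be a finite simple graph on vertex set V, let r ∈ V be a distinguished root vertex, and let f : V × V → ℝ be a function satisfying: (i) antisymmetry, f(u, v) = −f(v, u) for all u, v; (ii) support on edges, f(u, v) = 0 whenever {u, v} is not an edge of H; and (iii) unit demand, for every vertex v ≠ r the net inflow Σ_{u ∈ V} f(u, v) equals 1. Then every vertex of V is connected to r in H; in particular, if H is a spanning subgraph containing r, the existence of such a flow implies H is connected provided every vertex has a flow path, i.e., every v ∈ V is reachable from r in H. -/

import Mathlib

/-- The total of an antisymmetric function over ordered pairs from a finite set is zero. -/
theorem Finset.sum_sum_eq_zero_of_antisymm {V : Type*} (S : Finset V) (f : V → V → ℝ)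
    (hanti : ∀ u v, f u v = -f v u) : ∑ v ∈ S, ∑ u ∈ S, f u v = 0 := by
  have h : ∑ v ∈ S, ∑ u ∈ S, f u v = -∑ v ∈ S, ∑ u ∈ S, f u v := by
    conv_lhs => rw [Finset.sum_comm]
    simp only [← Finset.sum_neg_distrib]
    exact Finset.sum_congr rfl fun u _ => Finset.sum_congr rfl fun v _ => hanti u v
  linarith

/-- Correctness of the single-commodity-flow formulation of
connectivity: if a finite simple graph `H` carries an antisymmetric flow `f`
supported on its edges which delivers one unit of net inflow to every vertex
other than the root `r`, then every vertex of `H` is reachable from `r`. -/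
theorem flow_implies_connected
    {V : Type*} [Fintype V] (H : SimpleGraph V) (r : V) (f : V → V → ℝ)
    (hanti : ∀ u v, f u v = -f v u)
    (hsupp : ∀ u v, ¬H.Adj u v → f u v = 0)
    (hdem : ∀ v, v ≠ r → ∑ u, f u v = 1) :
    ∀ v, H.Reachable r v := by
  classical
  let S : Finset V := Finset.univ.filter fun v => ¬H.Reachable r v
  have mem_S (v : V) : v ∈ S ↔ ¬H.Reachable r v := by simp [S]
  have inflow (v : V) (hv : v ∈ S) : ∑ u ∈ S, f u v = 1 := by
    rw [mem_S] at hv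
    have hvr : v ≠ r := by
      rintro rfl
      exact hv (SimpleGraph.Reachable.refl v)
    rw [← hdem v hvr]
    refine Finset.sum_subset (Finset.subset_univ S) fun u _ hu => hsupp u v fun huv => ?_
    rw [mem_S, not_not] at hu
    exact hv (hu.trans huv.reachable)
  have card_eq : (S.card : ℝ) = 0 := by
    rw [← S.sum_sum_eq_zero_of_antisymm f hanti, Finset.sum_congr rfl inflow]
    simp
  have S_empty : S = ∅ := Finset.card_eq_zero.mp (by exact_mod_cast card_eq)
  intro v
  by_contra hv
  have hvS := (mem_S v).mpr hv
  simp [S_empty] at hvS
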